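/- (Property 3.) Let b and b_r be two structuring functions with nonempty finite supports Db and D_{br} and values < M on their supports, and define G_b(f)(x) = γ_b(f)(x) ⊟ γ_{b_r}(f)(x) (the LIP-difference of the two logarithmic openings; note γ_{b_r}(f)(x) < M so this is defined). Then for every constant c < M, G_b(f ⊞ c) = G_b(f), where (f ⊞ c)(y) = f(y) ⊞ c pointwise; i.e., the operator G_b is insensitive to the LIP-addition of any constant to f. -/

import Mathlib

/-- LIP-addition: a ⊞ b = a + b - a·b/M. -/
noncomputable def lipAdd (M a b : ℝ) : ℝ := a + b - a * b / M

/-- LIP-difference (defined when b < M): a ⊟ b = M·(a - b)/(M - b). -/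
noncomputable def lipSub (M a b : ℝ) : ℝ := M * (a - b) / (M - b)

/-- LIP-erosion of f by a structuring function a with support Da:
ε_a(f)(x) = min_{h ∈ Da} ( f(x+h) ⊟ a(h) ). -/
noncomputable def lipErosion (M : ℝ) {G : Type*} [AddCommGroup G]
    (Da : Finset G) (hne : Da.Nonempty) (a f : G → ℝ) (x : G) : ℝ :=
  Da.inf' hne fun h => lipSub M (f (x + h)) (a h)

/-- LIP-dilation of f by a structuring function a with support Da:
δ_a(f)(x) = max_{h ∈ Da} ( f(x−h) ⊞ a(h) ). -/
noncomputable def lipDilation (M : ℝ) {G : Type*} [AddCommGroup G]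
    (Da : Finset G) (hne : Da.Nonempty) (a f : G → ℝ) (x : G) : ℝ :=
  Da.sup' hne fun h => lipAdd M (f (x - h)) (a h)

/-- LIP-opening: γ_a(f) = δ_a(ε_a(f)). -/
noncomputable def lipOpening (M : ℝ) {G : Type*} [AddCommGroup G]
    (Da : Finset G) (hne : Da.Nonempty) (a f : G → ℝ) : G → ℝ :=
  lipDilation M Da hne a (lipErosion M Da hne a f)

theorem lipAdd_right_monotone {M c : ℝ} (hM : 0 < M) (hc : c ≤ M) :
    Monotone fun x => lipAdd M x c := by
  intro x y hxy
  have hcM : c / M ≤ 1 := (div_le_one hM).2 hc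
  simp only [lipAdd, mul_div_assoc]
  nlinarith [mul_nonneg (sub_nonneg.2 hxy) (sub_nonneg.2 hcM)]

theorem lipAdd_right_comm (M x y z : ℝ) :
    lipAdd M (lipAdd M x y) z = lipAdd M (lipAdd M x z) y := by
  unfold lipAdd
  ring

theorem lipSub_lipAdd_right_comm {M y : ℝ} (hM : M ≠ 0) (hy : y ≠ M) (x c : ℝ) :
    lipSub M (lipAdd M x c) y = lipAdd M (lipSub M x y) c := by
  have hMy : M - y ≠ 0 := sub_ne_zero.2 hy.symm
  unfold lipSub lipAdd
  field_simp
  ring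

theorem lipSub_lipAdd_lipAdd_right {M c : ℝ} (hM : M ≠ 0) (hc : c ≠ M) (x y : ℝ) :
    lipSub M (lipAdd M x c) (lipAdd M y c) = lipSub M x y := by
  have hcM : 1 - c / M ≠ 0 :=
    sub_ne_zero.2 fun h => hc ((div_eq_one_iff_eq hM).1 h.symm)
  have hnum : M * (lipAdd M x c - lipAdd M y c) = M * (x - y) * (1 - c / M) := by
    unfold lipAdd
    ring
  have hden : M - lipAdd M y c = (M - y) * (1 - c / M) := by
    unfold lipAdd
    field_simp
    ring
  rw [lipSub, hnum, hden, mul_div_mul_right _ _ hcM, lipSub]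

section

variable {M c : ℝ} {G : Type*} [AddCommGroup G] {Da : Finset G} {a : G → ℝ}

theorem lipErosion_lipAdd_const (hM : 0 < M) (hc : c ≤ M) (hne : Da.Nonempty)
    (ha : ∀ h ∈ Da, a h ≠ M) (f : G → ℝ) (x : G) :
    lipErosion M Da hne a (fun y => lipAdd M (f y) c) x =
      lipAdd M (lipErosion M Da hne a f x) c := by
  unfold lipErosion
  rw [Finset.apply_inf'_eq_inf'_comp hne (fun x => lipAdd M x c)
    fun _ _ => (lipAdd_right_monotone hM hc).map_inf _ _]
  exact Finset.inf'_congr hne rfl fun h hh => lipSub_lipAdd_right_comm hM.ne' (ha h hh) _ _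

theorem lipDilation_lipAdd_const (hM : 0 < M) (hc : c ≤ M) (hne : Da.Nonempty)
    (f : G → ℝ) (x : G) :
    lipDilation M Da hne a (fun y => lipAdd M (f y) c) x =
      lipAdd M (lipDilation M Da hne a f x) c := by
  unfold lipDilation
  rw [Finset.apply_sup'_eq_sup'_comp hne (fun x => lipAdd M x c)
    fun _ _ => (lipAdd_right_monotone hM hc).map_sup _ _]
  exact Finset.sup'_congr hne rfl fun h _ => lipAdd_right_comm _ _ _ _

theorem lipOpening_lipAdd_const (hM : 0 < M) (hc : c ≤ M) (hne : Da.Nonempty)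
    (ha : ∀ h ∈ Da, a h ≠ M) (f : G → ℝ) (x : G) :
    lipOpening M Da hne a (fun y => lipAdd M (f y) c) x =
      lipAdd M (lipOpening M Da hne a f x) c := by
  unfold lipOpening
  rw [funext (lipErosion_lipAdd_const hM hc hne ha f), lipDilation_lipAdd_const hM hc]

end

/-- Property 3: the operator
G_b(f)(x) = γ_b(f)(x) ⊟ γ_{b_r}(f)(x), the LIP-difference of the logarithmic
openings by two structuring functions b and b_r, is insensitive to the
LIP-addition of any constant c < M to the image f. -/
theorem lipSub_lipOpenings_lipAdd_const_invariant (M : ℝ) (hM : 0 < M)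
    {G : Type*} [AddCommGroup G]
    (Db : Finset G) (hne : Db.Nonempty) (b : G → ℝ) (hb : ∀ h ∈ Db, b h < M)
    (Dbr : Finset G) (hner : Dbr.Nonempty) (br : G → ℝ)
    (hbr : ∀ h ∈ Dbr, br h < M)
    (f : G → ℝ) (hf : ∀ x, f x < M) (c : ℝ) (hc : c < M) :
    let Gb : (G → ℝ) → G → ℝ := fun g x =>
      lipSub M (lipOpening M Db hne b g x) (lipOpening M Dbr hner br g x)
    Gb (fun y => lipAdd M (f y) c) = Gb f := by
  intro Gb
  funext x
  simp only [Gb]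
  rw [lipOpening_lipAdd_const hM hc.le hne fun h hh => (hb h hh).ne,
    lipOpening_lipAdd_const hM hc.le hner fun h hh => (hbr h hh).ne,
    lipSub_lipAdd_lipAdd_right hM.ne' hc.ne]
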